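/- arXiv:1311.5046 — 3 statements merged into one kernel-verified Lean document; each statement's English description precedes it below -/
import Mathlib

section
/- The complete graph K_9 admits a μ-simultaneous edge coloring for μ = 2 and for μ = 3. -/
open SimpleGraph

/-- A proper edge coloring of `G`: incident distinct edges receive different colors. -/
def IsProperEdgeColoring {V : Type*} (G : SimpleGraph V) (c : Sym2 V → ℕ) : Prop :=
  ∀ e₁ ∈ G.edgeSet, ∀ e₂ ∈ G.edgeSet, e₁ ≠ e₂ → (∃ v, v ∈ e₁ ∧ v ∈ e₂) → c e₁ ≠ c e₂

/-- The set of colors appearing on the edges of `G` incident to the vertex `v`. -/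
def colorsAt {V : Type*} (G : SimpleGraph V) (c : Sym2 V → ℕ) (v : V) : Set ℕ :=
  {k | ∃ e ∈ G.edgeSet, v ∈ e ∧ c e = k}

/-- A `μ`-simultaneous edge coloring of `G`: `μ` proper edge colorings such that at every
vertex the set of colors appearing on its incident edges is the same in all colorings, and
no edge gets the same color in two different colorings. -/
def IsSimultaneousEdgeColoring {V : Type*} (G : SimpleGraph V) (μ : ℕ)
    (c : Fin μ → Sym2 V → ℕ) : Prop :=
  (∀ i, IsProperEdgeColoring G (c i)) ∧
  (∀ i j : Fin μ, ∀ v : V, colorsAt G (c i) v = colorsAt G (c j) v) ∧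
  (∀ i j : Fin μ, i ≠ j → ∀ e ∈ G.edgeSet, c i e ≠ c j e)

/-- `G` admits a `μ`-simultaneous edge coloring. -/
def SimultaneousEdgeColorable {V : Type*} (G : SimpleGraph V) (μ : ℕ) : Prop :=
  ∃ c : Fin μ → Sym2 V → ℕ, IsSimultaneousEdgeColoring G μ c

theorem SimultaneousEdgeColorable.mono {V : Type*} {G : SimpleGraph V} {m n : ℕ} (hmn : m ≤ n)
    (h : SimultaneousEdgeColorable G n) : SimultaneousEdgeColorable G m := by
  obtain ⟨c, hproper, hcolors, hdisj⟩ := h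
  exact ⟨fun i => c (i.castLE hmn), fun i => hproper _, fun i j => hcolors _ _,
    fun i j hij => hdisj _ _ fun h => hij (Fin.castLE_injective hmn h)⟩

/-- The function on edges of the complete graph on an abelian group induced by a starter `f`:
the pair `{f d, f d + d}` is the one of difference `d` in the starter, and `{a, b}` is the
translate of such a pair by its color. -/
def starterColoring {A : Type*} [AddCommGroup A] (f : A → A) (hf : ∀ d, f (-d) = f d + d) :
    Sym2 A → A :=
  Sym2.lift ⟨fun a b => a - f (b - a), fun a b => by
    dsimp only
    rw [← neg_sub b a, hf]
    abel⟩

section Starter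

variable {A : Type*} [AddCommGroup A] {f : A → A} {hf : ∀ d, f (-d) = f d + d}

@[simp]
theorem starterColoring_mk (a b : A) : starterColoring f hf s(a, b) = a - f (b - a) := rfl

theorem isProperEdgeColoring_starterColoring (hinj : f.Injective) {g : A → ℕ}
    (hg : g.Injective) :
    IsProperEdgeColoring (completeGraph A) fun e => g (starterColoring f hf e) := by
  rintro e₁ - e₂ - hne ⟨v, ⟨a, rfl⟩, ⟨b, rfl⟩⟩ heq
  have h := hg heq
  simp only [starterColoring_mk, sub_right_inj] at h
  exact hne (by rw [sub_left_injective (hinj h)])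

theorem colorsAt_starterColoring (hf₀ : f 0 = 0) (hbij : f.Bijective) (g : A → ℕ) (v : A) :
    colorsAt (completeGraph A) (fun e => g (starterColoring f hf e)) v = g '' {v}ᶜ := by
  ext k
  constructor
  · rintro ⟨e, he, ⟨b, rfl⟩, rfl⟩
    refine ⟨_, fun h => ?_, rfl⟩
    rw [Set.mem_singleton_iff, starterColoring_mk, sub_eq_self, ← hf₀] at h
    exact he (sub_eq_zero.mp (hbij.injective h)).symm
  · rintro ⟨t, ht, rfl⟩
    obtain ⟨d, hd⟩ := hbij.surjective (v - t)
    refine ⟨s(v, v + d), fun h => ht ?_, Sym2.mem_mk_left _ _, by simp [hd]⟩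
    rw [left_eq_add.mp h, hf₀] at hd
    exact (sub_eq_zero.mp hd.symm).symm

end Starter

theorem simultaneousEdgeColorable_of_starters {A : Type*} [AddCommGroup A] [Finite A] {μ : ℕ}
    (f : Fin μ → A → A) (hf : ∀ i d, f i (-d) = f i d + d) (hf₀ : ∀ i, f i 0 = 0)
    (hinj : ∀ i, (f i).Injective) (hdisj : ∀ i j, i ≠ j → ∀ d, d ≠ 0 → f i d ≠ f j d) :
    SimultaneousEdgeColorable (completeGraph A) μ := by
  obtain ⟨g, hg⟩ := exists_injective_nat A
  refine ⟨fun i e => g (starterColoring (f i) (hf i) e),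
    fun i => isProperEdgeColoring_starterColoring (hinj i) hg, fun i j v => ?_, ?_⟩
  · rw [colorsAt_starterColoring (hf₀ i) (Finite.injective_iff_bijective.mp (hinj i)),
      colorsAt_starterColoring (hf₀ j) (Finite.injective_iff_bijective.mp (hinj j))]
  · rintro i j hij ⟨a, b⟩ he h
    refine hdisj i j hij (b - a) (fun h₀ => he (sub_eq_zero.mp h₀).symm) ?_
    simpa using hg h

/-- Three pairwise disjoint starters in the cyclic group of order nine. -/
def starterNine : Fin 3 → Fin 9 → Fin 9 :=
  ![![0, 1, 5, 3, 4, 8, 6, 7, 2], ![0, 7, 3, 1, 2, 6, 4, 5, 8], ![0, 2, 6, 4, 1, 5, 7, 8, 3]]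

theorem simultaneousEdgeColorable_completeGraph_nine_three :
    SimultaneousEdgeColorable (completeGraph (Fin 9)) 3 :=
  simultaneousEdgeColorable_of_starters starterNine (by decide) (by decide) (by decide)
    (by decide)

/-- The complete graph `K₉` admits a `μ`-simultaneous edge coloring for `μ = 2` and `μ = 3`. -/
theorem completeGraph_nine_simultaneousEdgeColorable :
    SimultaneousEdgeColorable (completeGraph (Fin 9)) 2 ∧
      SimultaneousEdgeColorable (completeGraph (Fin 9)) 3 := by
  exact ⟨simultaneousEdgeColorable_completeGraph_nine_three.mono (by norm_num),
    simultaneousEdgeColorable_completeGraph_nine_three⟩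
end

section
/- Let G and H be two μ-simultaneous edge colorable graphs. Then the Cartesian product G □ H is μ-simultaneous edge colorable, and moreover χ'_{μ-SE}(G □ H) ≤ χ'_{μ-SE}(G) + χ'_{μ-SE}(H). -/
open SimpleGraph

/-- The `μ`-SE chromatic number of `G`: the least `l` such that `G` has a `μ`-simultaneous
edge coloring using colors from `{1, …, l}`. -/
noncomputable def simSEChromaticNumber {V : Type*} (G : SimpleGraph V) (μ : ℕ) : ℕ :=
  sInf {l | ∃ c : Fin μ → Sym2 V → ℕ, IsSimultaneousEdgeColoring G μ c ∧
    ∀ (i : Fin μ), ∀ e ∈ G.edgeSet, c i e ∈ Set.Icc 1 l}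

theorem isProperEdgeColoring_iff {V : Type*} (G : SimpleGraph V) (c : Sym2 V → ℕ) :
    IsProperEdgeColoring G c ↔
      ∀ v w w', G.Adj v w → G.Adj v w' → c s(v, w) = c s(v, w') → w = w' := by
  constructor
  · intro h v w w' hw hw' hc
    by_contra hne
    exact h _ hw _ hw' (fun he => hne (Sym2.congr_right.1 he)) ⟨v, by simp, by simp⟩ hc
  · rintro h e₁ he₁ e₂ he₂ hne ⟨v, hv₁, hv₂⟩ hc
    obtain ⟨w, rfl⟩ := hv₁
    obtain ⟨w', rfl⟩ := hv₂
    exact hne (by rw [h v w w' he₁ he₂ hc])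

theorem mem_colorsAt_iff {V : Type*} {G : SimpleGraph V} {c : Sym2 V → ℕ} {v : V} {k : ℕ} :
    k ∈ colorsAt G c v ↔ ∃ w, G.Adj v w ∧ c s(v, w) = k := by
  constructor
  · rintro ⟨e, he, ⟨w, rfl⟩, hk⟩
    exact ⟨w, he, hk⟩
  · rintro ⟨w, hw, hk⟩
    exact ⟨s(v, w), hw, by simp, hk⟩

open Classical in
/-- The edge coloring of a box product that colors the copies of the first factor by `c` and the
copies of the second factor by `d`, shifted by `l`. -/
noncomputable def boxProdColoring {V W : Type*} (l : ℕ) (c : Sym2 V → ℕ) (d : Sym2 W → ℕ)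
    (e : Sym2 (V × W)) : ℕ :=
  if (e.map Prod.snd).IsDiag then c (e.map Prod.fst) else l + d (e.map Prod.snd)

section boxProdColoring

variable {V W : Type*} {G : SimpleGraph V} {H : SimpleGraph W} {l m : ℕ}

theorem boxProdColoring_left (c : Sym2 V → ℕ) (d : Sym2 W → ℕ) (v v' : V) (w : W) :
    boxProdColoring l c d s((v, w), (v', w)) = c s(v, v') := by
  simp [boxProdColoring]

theorem boxProdColoring_right (c : Sym2 V → ℕ) (d : Sym2 W → ℕ) (v : V) {w w' : W}
    (h : w ≠ w') : boxProdColoring l c d s((v, w), (v, w')) = l + d s(w, w') := by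
  simp [boxProdColoring, h]

theorem boxProdColoring_mem_Icc {c : Sym2 V → ℕ} {d : Sym2 W → ℕ}
    (hc : ∀ e ∈ G.edgeSet, c e ∈ Set.Icc 1 l) (hd : ∀ e ∈ H.edgeSet, d e ∈ Set.Icc 1 m) :
    ∀ e ∈ (G.boxProd H).edgeSet, boxProdColoring l c d e ∈ Set.Icc 1 (l + m) := by
  intro e
  induction e with
  | h x y =>
    obtain ⟨v, w⟩ := x
    obtain ⟨v', w'⟩ := y
    rintro (⟨h, he⟩ | ⟨h, he⟩) <;> dsimp only at h he <;> subst he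
    · rw [boxProdColoring_left]
      have := hc s(v, v') h
      simp only [Set.mem_Icc] at this ⊢
      omega
    · rw [boxProdColoring_right _ _ _ h.ne]
      have := hd s(w, w') h
      simp only [Set.mem_Icc] at this ⊢
      omega

theorem IsProperEdgeColoring.boxProd {c : Sym2 V → ℕ} {d : Sym2 W → ℕ}
    (hc : IsProperEdgeColoring G c) (hd : IsProperEdgeColoring H d)
    (hcl : ∀ e ∈ G.edgeSet, c e ≤ l) (hd₁ : ∀ e ∈ H.edgeSet, 1 ≤ d e) :
    IsProperEdgeColoring (G.boxProd H) (boxProdColoring l c d) := by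
  rw [isProperEdgeColoring_iff] at *
  rintro ⟨v, w⟩ ⟨v₁, w₁⟩ ⟨v₂, w₂⟩ (⟨h₁, e₁⟩ | ⟨h₁, e₁⟩) (⟨h₂, e₂⟩ | ⟨h₂, e₂⟩) <;>
    dsimp only at h₁ e₁ h₂ e₂ <;> subst e₁ <;> subst e₂
  · rw [boxProdColoring_left, boxProdColoring_left]
    intro h
    rw [hc _ _ _ h₁ h₂ h]
  · rw [boxProdColoring_left, boxProdColoring_right _ _ _ h₂.ne]
    intro h
    have := hcl s(v, v₁) h₁
    have := hd₁ s(w, w₂) h₂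
    omega
  · rw [boxProdColoring_left, boxProdColoring_right _ _ _ h₁.ne]
    intro h
    have := hcl s(v, v₂) h₂
    have := hd₁ s(w, w₁) h₁
    omega
  · rw [boxProdColoring_right _ _ _ h₁.ne, boxProdColoring_right _ _ _ h₂.ne]
    intro h
    rw [hd _ _ _ h₁ h₂ (Nat.add_left_cancel h)]

theorem colorsAt_boxProdColoring (c : Sym2 V → ℕ) (d : Sym2 W → ℕ) (v : V) (w : W) :
    colorsAt (G.boxProd H) (boxProdColoring l c d) (v, w) =
      colorsAt G c v ∪ (l + ·) '' colorsAt H d w := by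
  ext k
  simp only [Set.mem_union, Set.mem_image, mem_colorsAt_iff]
  constructor
  · rintro ⟨⟨v', w'⟩, ⟨h, he⟩ | ⟨h, he⟩, hk⟩ <;> dsimp only at h he <;> subst he
    · exact .inl ⟨v', h, by rw [← hk, boxProdColoring_left]⟩
    · exact .inr ⟨_, ⟨w', h, rfl⟩, by rw [← hk, boxProdColoring_right _ _ _ h.ne]⟩
  · rintro (⟨v', h, hk⟩ | ⟨_, ⟨w', h, rfl⟩, hk⟩)
    · exact ⟨(v', w), boxProd_adj_left.2 h, by rw [boxProdColoring_left, hk]⟩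
    · exact ⟨(v, w'), boxProd_adj_right.2 h, by rw [boxProdColoring_right _ _ _ h.ne, hk]⟩

theorem IsSimultaneousEdgeColoring.boxProd {μ : ℕ} {c : Fin μ → Sym2 V → ℕ}
    {d : Fin μ → Sym2 W → ℕ} (hc : IsSimultaneousEdgeColoring G μ c)
    (hd : IsSimultaneousEdgeColoring H μ d)
    (hcl : ∀ i, ∀ e ∈ G.edgeSet, c i e ≤ l) (hd₁ : ∀ i, ∀ e ∈ H.edgeSet, 1 ≤ d i e) :
    IsSimultaneousEdgeColoring (G.boxProd H) μ fun i => boxProdColoring l (c i) (d i) := by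
  refine ⟨fun i => (hc.1 i).boxProd (hd.1 i) (hcl i) (hd₁ i), ?_, ?_⟩
  · rintro i j ⟨v, w⟩
    rw [colorsAt_boxProdColoring, colorsAt_boxProdColoring, hc.2.1 i j, hd.2.1 i j]
  · intro i j hij e
    induction e with
    | h x y =>
      obtain ⟨v, w⟩ := x
      obtain ⟨v', w'⟩ := y
      rintro (⟨h, he⟩ | ⟨h, he⟩) <;> dsimp only at h he <;> subst he
      · simpa only [boxProdColoring_left] using hc.2.2 i j hij s(v, v') h
      · simpa only [boxProdColoring_right _ _ _ h.ne, ne_eq, Nat.add_left_cancel_iff]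
          using hd.2.2 i j hij s(w, w') h

end boxProdColoring

theorem IsSimultaneousEdgeColoring.add_one {V : Type*} {G : SimpleGraph V} {μ : ℕ}
    {c : Fin μ → Sym2 V → ℕ} (hc : IsSimultaneousEdgeColoring G μ c) :
    IsSimultaneousEdgeColoring G μ fun i e => c i e + 1 := by
  have key (i : Fin μ) (v : V) :
      colorsAt G (fun e => c i e + 1) v = (· + 1) '' colorsAt G (c i) v := by
    ext k
    simp [mem_colorsAt_iff]
  refine ⟨fun i e₁ h₁ e₂ h₂ hne hv h => hc.1 i e₁ h₁ e₂ h₂ hne hv (Nat.add_right_cancel h),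
    fun i j v => ?_, fun i j hij e he h => hc.2.2 i j hij e he (Nat.add_right_cancel h)⟩
  rw [key, key, hc.2.1 i j]

/-- A simultaneously edge colorable finite graph attains its `μ`-SE chromatic number. -/
theorem SimultaneousEdgeColorable.exists_coloring_mem_Icc {V : Type*} [Finite V]
    {G : SimpleGraph V} {μ : ℕ} (h : SimultaneousEdgeColorable G μ) :
    ∃ c : Fin μ → Sym2 V → ℕ, IsSimultaneousEdgeColoring G μ c ∧
      ∀ (i : Fin μ), ∀ e ∈ G.edgeSet, c i e ∈ Set.Icc 1 (simSEChromaticNumber G μ) := by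
  obtain ⟨c, hc⟩ := h
  have : Finite (Sym2 V) := Quot.finite _
  obtain ⟨M, hM⟩ := (Set.finite_range fun p : Fin μ × Sym2 V => c p.1 p.2).bddAbove
  exact Nat.sInf_mem (s := {l | ∃ c : Fin μ → Sym2 V → ℕ, IsSimultaneousEdgeColoring G μ c ∧
    ∀ (i : Fin μ), ∀ e ∈ G.edgeSet, c i e ∈ Set.Icc 1 l}) ⟨M + 1, _, hc.add_one, fun i e _ =>
      ⟨Nat.le_add_left _ _, Nat.add_le_add_right (hM ⟨(i, e), rfl⟩) 1⟩⟩

/-- If `G` and `H` are `μ`-simultaneous edge colorable, then so is `G □ H`; moreover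
`χ'_{μ-SE}(G □ H) ≤ χ'_{μ-SE}(G) + χ'_{μ-SE}(H)`. -/
theorem boxProd_simultaneousEdgeColorable
    {V W : Type*} [Fintype V] [Fintype W] (G : SimpleGraph V) (H : SimpleGraph W) (μ : ℕ)
    (hG : SimultaneousEdgeColorable G μ) (hH : SimultaneousEdgeColorable H μ) :
    SimultaneousEdgeColorable (G.boxProd H) μ ∧
      simSEChromaticNumber (G.boxProd H) μ ≤
        simSEChromaticNumber G μ + simSEChromaticNumber H μ := by
  obtain ⟨c, hc, hcI⟩ := hG.exists_coloring_mem_Icc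
  obtain ⟨d, hd, hdI⟩ := hH.exists_coloring_mem_Icc
  have hcd := hc.boxProd hd (fun i e he => (hcI i e he).2) fun i e he => (hdI i e he).1
  exact ⟨⟨_, hcd⟩, Nat.sInf_le ⟨_, hcd, fun i => boxProdColoring_mem_Icc (hcI i) (hdI i)⟩⟩
end

section
/- Let G be a bridgeless bipartite graph that is not 2-simultaneous edge colorable, such that every bridgeless bipartite graph with fewer edges than G is 2-simultaneous edge colorable, and every bridgeless bipartite graph with the same number of edges as G and more vertices than G is 2-simultaneous edge colorable. Then the minimum degree of G is 2 and the maximum degree of G is 3. -/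
open SimpleGraph

/-- The edge cut determined by a vertex set `S`: all edges with one endpoint in `S`
and the other in its complement. -/
def cutEdges {V : Type*} (G : SimpleGraph V) (S : Set V) : Set (Sym2 V) :=
  {e | e ∈ G.edgeSet ∧ ∃ a ∈ S, ∃ b ∈ Sᶜ, e = s(a, b)}

/-- `G` is `k`-edge-connected: it is connected and every edge cut has at least `k` edges. -/
def IsKEdgeConnected {V : Type*} (G : SimpleGraph V) (k : ℕ) : Prop :=
  G.Connected ∧ ∀ S : Set V, S.Nonempty → Sᶜ.Nonempty → k ≤ (cutEdges G S).ncard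


section OrientedCycleDoubleCover

open Equiv

/-- A partial injection with equal domain and range extends by the identity to a permutation. -/
theorem exists_perm_of_rel {V : Type*} [Finite V] (R : V → V → Prop)
    (hfun : ∀ u w w', R u w → R u w' → w = w')
    (hinj : ∀ u u' w, R u w → R u' w → u = u')
    (hdom : ∀ u, (∃ w, R w u) → ∃ w, R u w) :
    ∃ φ : Perm V, (∀ u w, R u w → φ u = w) ∧ ∀ u, φ u ≠ u → R u (φ u) := by
  classical
  let f : V → V := fun u => if h : ∃ w, R u w then h.choose else u
  have hf : ∀ u w, R u w → f u = w := fun u w h => by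
    have hex : ∃ w, R u w := ⟨w, h⟩
    simp only [f, dif_pos hex]
    exact hfun _ _ _ hex.choose_spec h
  have hf' : ∀ u, (¬ ∃ w, R u w) → f u = u := fun u h => by simp only [f, dif_neg h]
  have hinjf : Function.Injective f := by
    intro u u' h
    by_cases hu : ∃ w, R u w <;> by_cases hu' : ∃ w, R u' w
    · obtain ⟨w, hw⟩ := hu
      obtain ⟨w', hw'⟩ := hu'
      rw [hf _ _ hw, hf _ _ hw'] at h
      subst h
      exact hinj _ _ _ hw hw'
    · obtain ⟨w, hw⟩ := hu
      rw [hf _ _ hw, hf' _ hu'] at h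
      subst h
      exact absurd (hdom _ ⟨u, hw⟩) hu'
    · obtain ⟨w, hw⟩ := hu'
      rw [hf _ _ hw, hf' _ hu] at h
      subst h
      exact absurd (hdom _ ⟨u', hw⟩) hu
    · rwa [hf' _ hu, hf' _ hu'] at h
  refine ⟨Equiv.ofBijective f (Finite.injective_iff_bijective.mp hinjf), hf, fun u hu => ?_⟩
  by_cases h : ∃ w, R u w
  · obtain ⟨w, hw⟩ := h
    have : f u = w := hf _ _ hw
    simpa [this] using hw
  · exact absurd (hf' u h) hu

/-- After possibly composing with the transposition of two points, a permutation has them in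
different cycles. -/
theorem exists_not_sameCycle {W : Type*} [Finite W] [DecidableEq W] (φ : Perm W) {p q : W}
    (hpq : p ≠ q) :
    ∃ θ : Perm W, (θ = φ ∨ θ = swap p q * φ) ∧ ¬ θ.SameCycle p q := by
  by_cases hsame : φ.SameCycle p q
  swap
  · exact ⟨φ, Or.inl rfl, hsame⟩
  refine ⟨swap p q * φ, Or.inr rfl, fun hsc => ?_⟩
  have hex := hsame.exists_nat_pow_eq
  classical
  obtain ⟨k, hk, hmin⟩ : ∃ k : ℕ, (φ ^ k) p = q ∧ ∀ j < k, (φ ^ j) p ≠ q :=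
    ⟨Nat.find hex, Nat.find_spec hex, fun j hj => Nat.find_min hex hj⟩
  have hk0 : 0 < k := by
    rcases Nat.eq_zero_or_pos k with rfl | h
    · exact absurd hk (by simpa using hpq)
    · exact h
  have hstay : ∀ n : ℕ, ∃ j < k, ((swap p q * φ) ^ n) p = (φ ^ j) p := by
    intro n
    induction n with
    | zero => exact ⟨0, hk0, by simp⟩
    | succ n ih =>
      obtain ⟨j, hj, hjn⟩ := ih
      have hstep : ((swap p q * φ) ^ (n + 1)) p = swap p q ((φ ^ (j + 1)) p) := by
        rw [pow_succ', Perm.mul_apply, hjn, Perm.mul_apply, pow_succ', Perm.mul_apply]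
      rcases Nat.lt_or_ge (j + 1) k with hlt | hge
      · refine ⟨j + 1, hlt, ?_⟩
        rw [hstep, swap_apply_of_ne_of_ne _ (hmin _ hlt)]
        intro hp
        refine hmin (k - (j + 1)) (by omega) ?_
        rw [← hk]
        conv_rhs => rw [← Nat.sub_add_cancel hlt.le, pow_add, Perm.mul_apply, hp]
      · refine ⟨0, hk0, ?_⟩
        have : j + 1 = k := by omega
        rw [hstep, this, hk]
        simp
  obtain ⟨n, hn⟩ := hsc.exists_nat_pow_eq
  obtain ⟨j, hj, hjn⟩ := hstay n
  exact hmin j hj (hjn.symm.trans hn)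

/-- The part of a permutation of `W` supported on an invariant set `C` pushes forward along a map
that is injective on `C`. -/
theorem exists_perm_pushforward {W V : Type*} [Finite V] (θ : Perm W) (π : W → V) (C : Set W)
    (hC : ∀ a, θ a ∈ C ↔ a ∈ C) (hπ : Set.InjOn π C) :
    ∃ ψ : Perm V, (∀ a ∈ C, ψ (π a) = π (θ a)) ∧ ∀ u, ψ u ≠ u → ∃ a ∈ C, π a = u := by
  obtain ⟨ψ, h₁, h₂⟩ := exists_perm_of_rel (V := V)
    (fun u w => ∃ a ∈ C, π a = u ∧ π (θ a) = w)
    (by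
      rintro u w w' ⟨a, ha, rfl, rfl⟩ ⟨b, hb, hab, rfl⟩
      rw [hπ hb ha hab])
    (by
      rintro u u' w ⟨a, ha, rfl, rfl⟩ ⟨b, hb, rfl, hab⟩
      rw [θ.injective (hπ ((hC b).2 hb) ((hC a).2 ha) hab)])
    (by
      rintro u ⟨w, a, ha, rfl, rfl⟩
      exact ⟨π (θ (θ a)), θ a, (hC a).2 ha, rfl, rfl⟩)
  refine ⟨ψ, fun a ha => h₁ _ _ ⟨a, ha, rfl, rfl⟩, fun u hu => ?_⟩
  obtain ⟨a, ha, hau, -⟩ := h₂ u hu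
  exact ⟨a, ha, hau⟩

/-- An oriented cycle double cover of `G`, as a family of permutations whose nontrivial cycles are
directed cycles of `G` of length at least three, together covering every dart exactly once. -/
structure IsOrientedCycleDoubleCover {V ι : Type*} (G : SimpleGraph V) (φ : ι → Perm V) :
    Prop where
  adj : ∀ i u, φ i u ≠ u → G.Adj u (φ i u)
  existsUnique : ∀ u w, G.Adj u w → ∃! i, φ i u = w
  eq_self : ∀ i u, φ i (φ i u) = u → φ i u = u

theorem coloring_ne_iff {V : Type*} {G : SimpleGraph V} (b : G.Coloring (Fin 2)) {u w : V}
    (h : G.Adj u w) (k : Fin 2) : b u ≠ k ↔ b w = k := by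
  have := b.valid h
  omega

theorem SimultaneousEdgeColorable.exists_isOrientedCycleDoubleCover {V : Type*} [Finite V]
    {G : SimpleGraph V} (hb : G.Colorable 2) (hG : SimultaneousEdgeColorable G 2) :
    ∃ φ : ℕ → Perm V, IsOrientedCycleDoubleCover G φ := by
  obtain ⟨b⟩ := hb
  obtain ⟨c, hproper, hcolors, hne⟩ := hG
  have huniq : ∀ k u w w', G.Adj u w → G.Adj u w' → c k s(u, w) = c k s(u, w') → w = w' := by
    intro k u w w' h h' hc
    by_contra hww
    exact hproper k s(u, w) h s(u, w') h' (fun he => hww (Sym2.congr_right.mp he))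
      ⟨u, by simp, by simp⟩ hc
  have key : ∀ i : ℕ, ∃ φ : Perm V,
      (∀ u w, (G.Adj u w ∧ c (b u) s(u, w) = i) → φ u = w) ∧
      ∀ u, φ u ≠ u → (G.Adj u (φ u) ∧ c (b u) s(u, φ u) = i) := by
    intro i
    refine exists_perm_of_rel (fun u w => G.Adj u w ∧ c (b u) s(u, w) = i) ?_ ?_ ?_
    · rintro u w w' ⟨h, hc⟩ ⟨h', hc'⟩
      exact huniq _ _ _ _ h h' (hc.trans hc'.symm)
    · rintro u u' w ⟨h, hc⟩ ⟨h', hc'⟩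
      have hbu : b u = b u' := by
        have := b.valid h
        have := b.valid h'
        omega
      rw [Sym2.eq_swap, hbu] at hc
      rw [Sym2.eq_swap] at hc'
      exact huniq _ _ _ _ h.symm h'.symm (hc.trans hc'.symm)
    · rintro u ⟨w, h, hc⟩
      have hi : i ∈ colorsAt G (c (b w)) u := ⟨s(w, u), h, by simp, hc⟩
      rw [hcolors (b w) (b u)] at hi
      obtain ⟨e, he, hue, hce⟩ := hi
      obtain ⟨x, rfl⟩ := Sym2.mem_iff_exists.mp hue
      exact ⟨x, he, hce⟩
  choose φ h₁ h₂ using key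
  refine ⟨φ, fun i u hu => (h₂ i u hu).1, fun u w h => ?_, fun i u h => ?_⟩
  · refine ⟨_, h₁ _ u w ⟨h, rfl⟩, fun j hj => ?_⟩
    dsimp only at hj
    have := (h₂ j u (by rw [hj]; exact h.ne')).2
    rw [← this, hj]
  · by_contra hu
    obtain ⟨ha, hc⟩ := h₂ i u hu
    obtain ⟨ha', hc'⟩ := h₂ i (φ i u) (by rw [h]; exact fun h => hu h.symm)
    rw [h, Sym2.eq_swap] at hc'
    exact hne _ _ (b.valid ha) _ ha (hc.trans hc'.symm)

theorem IsOrientedCycleDoubleCover.simultaneousEdgeColorable {V ι : Type*} [Countable ι]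
    {G : SimpleGraph V} (hb : G.Colorable 2) {φ : ι → Perm V}
    (hφ : IsOrientedCycleDoubleCover G φ) : SimultaneousEdgeColorable G 2 := by
  classical
  obtain ⟨b⟩ := hb
  obtain ⟨enc, henc⟩ := Countable.exists_injective_nat ι
  let c : Fin 2 → Sym2 V → ℕ := fun k e =>
    if h : ∃ i u w, e = s(u, w) ∧ b u = k ∧ φ i u = w then enc h.choose else 0
  have hc : ∀ u w, G.Adj u w → ∀ i, φ i u = w → c (b u) s(u, w) = enc i := by
    intro u w h i hi
    have hex : ∃ i u' w', s(u, w) = s(u', w') ∧ b u' = b u ∧ φ i u' = w' :=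
      ⟨i, u, w, rfl, rfl, hi⟩
    simp only [c, dif_pos hex]
    obtain ⟨u', w', he, hbu, hi'⟩ := hex.choose_spec
    congr 1
    rcases Sym2.eq_iff.mp he with ⟨rfl, rfl⟩ | ⟨rfl, rfl⟩
    · exact (hφ.existsUnique _ _ h).unique hi' hi
    · exact absurd hbu.symm (b.valid h)
  have hc' : ∀ u w, G.Adj u w → ∃ i, φ i u = w ∧ c (b u) s(u, w) = enc i := by
    intro u w h
    obtain ⟨i, hi, -⟩ := hφ.existsUnique u w h
    exact ⟨i, hi, hc u w h i hi⟩
  have hcolors : ∀ k v, colorsAt G (c k) v = enc '' {i | φ i v ≠ v} := by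
    intro k v
    ext n
    constructor
    · rintro ⟨e, he, hve, rfl⟩
      obtain ⟨w, rfl⟩ := Sym2.mem_iff_exists.mp hve
      have h : G.Adj v w := he
      by_cases hk : b v = k
      · subst hk
        obtain ⟨i, hi, hci⟩ := hc' v w h
        exact ⟨i, by simpa [hi] using h.ne', hci.symm⟩
      · rw [← ne_eq, coloring_ne_iff b h] at hk
        subst hk
        obtain ⟨i, hi, hci⟩ := hc' w v h.symm
        refine ⟨i, fun hfix => h.ne' ((φ i).injective (hi.trans hfix.symm)), ?_⟩
        rw [← hci, Sym2.eq_swap]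
    · rintro ⟨i, hi, rfl⟩
      have h := hφ.adj i v hi
      by_cases hk : b v = k
      · subst hk
        exact ⟨s(v, φ i v), h, by simp, hc _ _ h _ rfl⟩
      · have hw : φ i ((φ i).symm v) = v := (φ i).apply_symm_apply v
        have h' := hφ.adj i ((φ i).symm v) (by
          rw [hw]
          exact fun hfix => hi (by rw [hfix, hw, ← hfix]))
        rw [hw] at h'
        rw [← ne_eq, coloring_ne_iff b h'.symm] at hk
        subst hk
        exact ⟨s((φ i).symm v, v), h', by simp, hc _ _ h' _ hw⟩
  refine ⟨c, ?_, fun i j v => by rw [hcolors, hcolors], ?_⟩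
  · rintro k e₁ he₁ e₂ he₂ hne ⟨v, hv₁, hv₂⟩ heq
    obtain ⟨w₁, rfl⟩ := Sym2.mem_iff_exists.mp hv₁
    obtain ⟨w₂, rfl⟩ := Sym2.mem_iff_exists.mp hv₂
    have h₁ : G.Adj v w₁ := he₁
    have h₂ : G.Adj v w₂ := he₂
    apply hne
    by_cases hk : b v = k
    · subst hk
      obtain ⟨i, hi, hci⟩ := hc' v w₁ h₁
      obtain ⟨j, hj, hcj⟩ := hc' v w₂ h₂
      have : i = j := henc (hci.symm.trans (heq.trans hcj))
      subst this
      rw [← hi, ← hj]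
    · have hk₁ := (coloring_ne_iff b h₁ k).mp hk
      have hk₂ := (coloring_ne_iff b h₂ k).mp hk
      obtain ⟨i, hi, hci⟩ := hc' w₁ v h₁.symm
      obtain ⟨j, hj, hcj⟩ := hc' w₂ v h₂.symm
      rw [hk₁, Sym2.eq_swap] at hci
      rw [hk₂, Sym2.eq_swap] at hcj
      have : i = j := henc (hci.symm.trans (heq.trans hcj))
      subst this
      rw [(φ i).injective (hi.trans hj.symm)]
  · intro k l hkl e he heq
    induction e with | h u w => ?_
    have h : G.Adj u w := he
    obtain ⟨i, hi, hci⟩ := hc' u w h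
    obtain ⟨j, hj, hcj⟩ := hc' w u h.symm
    have hij : c (b u) s(u, w) = c (b w) s(u, w) := by
      have := b.valid h
      rcases (by omega : (b u = k ∧ b w = l) ∨ (b u = l ∧ b w = k)) with ⟨h₁, h₂⟩ | ⟨h₁, h₂⟩ <;>
        rw [h₁, h₂]
      · exact heq
      · exact heq.symm
    rw [Sym2.eq_swap] at hcj
    have : i = j := henc (hci.symm.trans (hij.trans hcj))
    subst this
    exact h.ne' (hi.symm.trans (hφ.eq_self i u (by rw [hi, hj])))

end OrientedCycleDoubleCover

section Split

variable {V : Type*} {v : V} {A : Set V}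

/-- The projection identifying the new vertex `none` with `v`. -/
def splitProj (v : V) (a : Option V) : V := a.getD v

open Classical in
/-- The copy of `u` at which the split edge from `u` to `w` starts. -/
noncomputable def splitLift (v : V) (A : Set V) (u w : V) : Option V :=
  if u = v ∧ w ∈ A then none else some u

theorem splitProj_splitLift (u w : V) : splitProj v (splitLift v A u w) = u := by
  unfold splitLift
  split_ifs with h
  · exact h.1.symm
  · rfl

/-- The graph obtained from `G` by splitting the vertex `v` in two: the new vertex `none` takes
over the edges from `v` to `A`. -/
def splitGraph (G : SimpleGraph V) (v : V) (A : Set V) : SimpleGraph (Option V) where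
  Adj a b := G.Adj (splitProj v a) (splitProj v b) ∧
    a = splitLift v A (splitProj v a) (splitProj v b) ∧
    b = splitLift v A (splitProj v b) (splitProj v a)
  symm := ⟨fun _ _ h => ⟨h.1.symm, h.2.2, h.2.1⟩⟩
  loopless := ⟨fun _ h => h.1.ne rfl⟩

variable {G : SimpleGraph V}

theorem splitGraph_adj_splitLift {u w : V} (h : G.Adj u w) :
    (splitGraph G v A).Adj (splitLift v A u w) (splitLift v A w u) := by
  simp [splitGraph, splitProj_splitLift, h]

theorem splitGraph_colorable {n : ℕ} (hG : G.Colorable n) : (splitGraph G v A).Colorable n := by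
  obtain ⟨b⟩ := hG
  exact ⟨b.comp ⟨splitProj v, fun h => h.1⟩⟩

theorem splitGraph_ncard_edgeSet : (splitGraph G v A).edgeSet.ncard = G.edgeSet.ncard := by
  refine Set.ncard_congr (fun e _ => e.map (splitProj v)) ?_ ?_ ?_
  · intro e he
    induction e with | h a b => exact he.1
  · intro e f he hf hef
    induction e with | h a b => ?_
    induction f with | h c d => ?_
    obtain ⟨-, ha, hb⟩ : (splitGraph G v A).Adj a b := he
    obtain ⟨-, hc, hd⟩ : (splitGraph G v A).Adj c d := hf
    refine Sym2.eq_iff.mpr ((Sym2.eq_iff.mp hef).imp ?_ ?_) <;> rintro ⟨h₁, h₂⟩ <;>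
      rw [h₁, h₂] at ha hb
    · exact ⟨ha.trans hc.symm, hb.trans hd.symm⟩
    · exact ⟨ha.trans hd.symm, hb.trans hc.symm⟩
  · intro e he
    induction e with | h u w => ?_
    exact ⟨s(splitLift v A u w, splitLift v A w u), splitGraph_adj_splitLift he,
      by simp [splitProj_splitLift]⟩

open Equiv in
/-- Identifying two vertices without common neighbours preserves the existence of an oriented
cycle double cover: cycles through both vertices are cut in two. -/
theorem IsOrientedCycleDoubleCover.of_splitGraph [Finite V] {ι : Type*} {φ : ι → Perm (Option V)}
    (hφ : IsOrientedCycleDoubleCover (splitGraph G v A) φ) :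
    ∃ ψ : ι × Bool → Perm V, IsOrientedCycleDoubleCover G ψ := by
  classical
  choose θ hθ hsc using fun i => exists_not_sameCycle (φ i) (p := none) (q := some v) (by simp)
  have hproj : ∀ i a, splitProj v (θ i a) = splitProj v (φ i a) := by
    intro i a
    rcases hθ i with h | h
    · rw [h]
    · rw [h, Perm.mul_apply]
      by_cases h₁ : φ i a = none
      · simp [h₁, splitProj]
      · by_cases h₂ : φ i a = some v
        · simp [h₂, splitProj]
        · rw [swap_apply_of_ne_of_ne h₁ h₂]
  let C : ι × Bool → Set (Option V) := fun i => {a | (θ i.1).SameCycle none a ↔ i.2 = true}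
  have hC : ∀ i a, θ i.1 a ∈ C i ↔ a ∈ C i := fun i a => by simp [C]
  have hinj : ∀ i, Set.InjOn (splitProj v) (C i) := by
    rintro ⟨i, t⟩ a ha b hb hab
    have h₁ : (θ i).SameCycle none none := .refl _ _
    have h₂ := hsc i
    simp only [C, Set.mem_ofPred_eq] at ha hb
    rcases a with - | a <;> rcases b with - | b <;> simp only [splitProj, Option.getD] at hab
    · rfl
    · subst hab; tauto
    · subst hab; tauto
    · rw [hab]
  choose ψ h₁ h₂ using fun i => exists_perm_pushforward (θ i.1) (splitProj v) (C i) (hC i) (hinj i)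
  have hstep : ∀ i u w, ψ i u = w → u ≠ w →
      splitLift v A u w ∈ C i ∧ φ i.1 (splitLift v A u w) = splitLift v A w u ∧ G.Adj u w := by
    rintro i u w rfl hne
    obtain ⟨a, ha, rfl⟩ := h₂ i u hne.symm
    have hw := h₁ i a ha
    rw [hproj] at hw
    rw [hw] at hne ⊢
    have hadj := hφ.adj i.1 a (fun h => hne (by rw [h]))
    rw [← hadj.2.1]
    exact ⟨ha, hadj.2.2, hadj.1⟩
  refine ⟨ψ, fun i u hu => (hstep i u _ rfl hu.symm).2.2, fun u w h => ?_, fun i u h => ?_⟩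
  · obtain ⟨i, hi, huniq⟩ := hφ.existsUnique _ _ (splitGraph_adj_splitLift (v := v) (A := A) h)
    refine ⟨(i, decide ((θ i).SameCycle none (splitLift v A u w))), ?_, ?_⟩
    · have := h₁ (i, decide ((θ i).SameCycle none (splitLift v A u w))) (splitLift v A u w)
        (by simp [C])
      rwa [hproj, splitProj_splitLift, hi, splitProj_splitLift] at this
    · rintro ⟨j, t⟩ hj
      obtain ⟨hmem, hj', -⟩ := hstep _ u w hj h.ne
      have : j = i := huniq j hj'
      subst this
      simp only [C, Set.mem_ofPred_eq] at hmem
      ext1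
      · rfl
      · simp [hmem]
  · by_contra hu
    obtain ⟨-, ha, hadj⟩ := hstep i u _ rfl (fun h => hu h.symm)
    obtain ⟨-, hb, -⟩ := hstep i _ u h hu
    have heq := hφ.eq_self i.1 (splitLift v A u (ψ i u)) (by rw [ha, hb])
    rw [ha] at heq
    apply hu
    rw [← splitProj_splitLift (v := v) (A := A) (ψ i u) u, heq, splitProj_splitLift]

theorem cutEdges_compl (S : Set V) : cutEdges G Sᶜ = cutEdges G S := by
  ext e
  constructor <;> rintro ⟨he, a, ha, b, hb, rfl⟩ <;>
    exact ⟨he, b, by simpa using hb, a, by simpa using ha, Sym2.eq_swap⟩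

theorem mem_cutEdges {S : Set V} {a b : V} (h : G.Adj a b) (ha : a ∈ S) (hb : b ∉ S) :
    s(a, b) ∈ cutEdges G S :=
  ⟨h, a, ha, b, hb, rfl⟩

theorem connected_of_cutEdges_nonempty [Nonempty V]
    (h : ∀ S : Set V, S.Nonempty → Sᶜ.Nonempty → (cutEdges G S).Nonempty) : G.Connected := by
  obtain ⟨x⟩ := ‹Nonempty V›
  rw [connected_iff_exists_forall_reachable]
  refine ⟨x, fun y => ?_⟩
  by_contra hy
  obtain ⟨e, he, a, ha, b, hb, rfl⟩ := h {z | G.Reachable x z} ⟨x, .refl _⟩ ⟨y, hy⟩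
  exact hb (ha.trans (Adj.reachable he))

theorem isKEdgeConnected_of_cutEdges [Nonempty V] {k : ℕ} (hk : 0 < k)
    (h : ∀ S : Set V, S.Nonempty → Sᶜ.Nonempty → k ≤ (cutEdges G S).ncard) :
    IsKEdgeConnected G k :=
  ⟨connected_of_cutEdges_nonempty fun S h₁ h₂ =>
    Set.nonempty_of_ncard_ne_zero (by have := h S h₁ h₂; omega), h⟩

theorem splitGraph_isKEdgeConnected [Finite V] (hG : IsKEdgeConnected G 2) {w₀ w₁ : V}
    (hne : w₀ ≠ w₁) (h₀ : G.Adj v w₀) (h₁ : G.Adj v w₁)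
    (hcut : ∀ T : Set V, v ∉ T → w₀ ∈ T → w₁ ∈ T → 4 ≤ (cutEdges G T).ncard) :
    IsKEdgeConnected (splitGraph G v {w₀, w₁}) 2 := by
  have hL : ∀ u w, G.Adj u w → ∀ S : Set (Option V), splitLift v {w₀, w₁} u w ∈ S →
      splitLift v {w₀, w₁} w u ∉ S →
      s(u, w) ∈ Sym2.map (splitProj v) '' cutEdges (splitGraph G v {w₀, w₁}) S :=
    fun u w h S hu hw => ⟨_, mem_cutEdges (splitGraph_adj_splitLift h) hu hw,
      by simp [splitProj_splitLift]⟩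
  have hlift : ∀ u w, ¬ (u = v ∧ (w = w₀ ∨ w = w₁)) → splitLift v {w₀, w₁} u w = some u := by
    intro u w h
    simp [splitLift, h]
  have hlift₀ : splitLift v {w₀, w₁} v w₀ = none := by simp [splitLift]
  have hlift₁ : splitLift v {w₀, w₁} v w₁ = none := by simp [splitLift]
  have hlift₀' : splitLift v {w₀, w₁} w₀ v = some w₀ := by simp [splitLift, h₀.ne']
  have hlift₁' : splitLift v {w₀, w₁} w₁ v = some w₁ := by simp [splitLift, h₁.ne']
  have main : ∀ S : Set (Option V), none ∈ S → Sᶜ.Nonempty →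
      2 ≤ (cutEdges (splitGraph G v {w₀, w₁}) S).ncard := by
    intro S hS hSc
    refine le_trans ?_ (Set.ncard_image_le (f := Sym2.map (splitProj v)) (Set.toFinite _))
    set I := Sym2.map (splitProj v) '' cutEdges (splitGraph G v {w₀, w₁}) S with hI
    by_cases hv : some v ∈ S
    · refine le_trans (hG.2 {u | some u ∈ S} ⟨v, hv⟩ ?_) (Set.ncard_le_ncard ?_ (Set.toFinite _))
      · obtain ⟨a, ha⟩ := hSc
        rcases a with - | a
        · exact absurd hS ha
        · exact ⟨a, ha⟩
      · rintro e ⟨he, a, ha, b, hb, rfl⟩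
        refine hL a b he S ?_ ?_
        · unfold splitLift
          split_ifs
          exacts [hS, ha]
        · unfold splitLift
          split_ifs with h
          · exact absurd (h.1 ▸ hv) hb
          · exact hb
    · set T : Set V := {u | some u ∈ S} with hT
      have hvT : v ∉ T := hv
      have hTI : cutEdges G T ⊆ insert s(v, w₀) (insert s(v, w₁) I) := by
        rintro e ⟨he, a, ha, b, hb, rfl⟩
        by_cases hb' : b = v ∧ (a = w₀ ∨ a = w₁)
        · rcases hb' with ⟨rfl, rfl | rfl⟩ <;> simp [Sym2.eq_swap]
        · refine Or.inr (Or.inr (hL a b he S ?_ ?_))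
          · rwa [hlift]
            rintro ⟨rfl, -⟩
            exact hvT ha
          · rwa [hlift _ _ hb']
      have hmem₀ : w₀ ∉ T → s(v, w₀) ∈ I := fun h =>
        hL v w₀ h₀ S (by rwa [hlift₀]) (by rwa [hlift₀'])
      have hmem₁ : w₁ ∉ T → s(v, w₁) ∈ I := fun h =>
        hL v w₁ h₁ S (by rwa [hlift₁]) (by rwa [hlift₁'])
      have hedge : s(v, w₀) ≠ s(v, w₁) := fun h => hne (Sym2.congr_right.mp h)
      have hnot : ∀ w, w ∉ T → s(v, w) ∉ cutEdges G T := by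
        rintro w hw ⟨-, a, ha, b, -, h⟩
        rcases Sym2.eq_iff.mp h with ⟨rfl, rfl⟩ | ⟨rfl, rfl⟩
        exacts [hvT ha, hw ha]
      have hTle := Set.ncard_le_ncard hTI (Set.toFinite _)
      by_cases hw₀ : w₀ ∈ T <;> by_cases hw₁ : w₁ ∈ T
      · have := hcut T hvT hw₀ hw₁
        have := Set.ncard_insert_le s(v, w₀) (insert s(v, w₁) I)
        have := Set.ncard_insert_le s(v, w₁) I
        omega
      · have h2 := hG.2 T ⟨w₀, hw₀⟩ ⟨v, hvT⟩
        have hsub : insert s(v, w₁) (cutEdges G T) ⊆ insert s(v, w₀) I := by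
          refine Set.insert_subset (Or.inr (hmem₁ hw₁)) (hTI.trans ?_)
          rw [Set.insert_eq_of_mem (hmem₁ hw₁)]
        have := Set.ncard_le_ncard hsub (Set.toFinite _)
        rw [Set.ncard_insert_of_notMem (hnot _ hw₁) (Set.toFinite _)] at this
        have := Set.ncard_insert_le s(v, w₀) I
        omega
      · have h2 := hG.2 T ⟨w₁, hw₁⟩ ⟨v, hvT⟩
        have hsub : insert s(v, w₀) (cutEdges G T) ⊆ insert s(v, w₁) I := by
          refine Set.insert_subset (Or.inr (hmem₀ hw₀)) (hTI.trans ?_)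
          rw [Set.insert_eq_of_mem (Set.mem_insert_of_mem _ (hmem₀ hw₀))]
        have := Set.ncard_le_ncard hsub (Set.toFinite _)
        rw [Set.ncard_insert_of_notMem (hnot _ hw₀) (Set.toFinite _)] at this
        have := Set.ncard_insert_le s(v, w₁) I
        omega
      · rw [← Set.ncard_pair hedge]
        refine Set.ncard_le_ncard ?_ (Set.toFinite _)
        rintro e (rfl | rfl)
        exacts [hmem₀ hw₀, hmem₁ hw₁]
  refine isKEdgeConnected_of_cutEdges two_pos fun S hS hSc => ?_
  by_cases h : none ∈ S
  · exact main S h hSc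
  · rw [← cutEdges_compl]
    exact main Sᶜ h (by rwa [compl_compl])

end Split

section Pair

variable {V : Type*} {G : SimpleGraph V} {v : V}

theorem four_le_ncard {α : Type*} {s : Set α} (hs : s.Finite) {a b c d : α} (ha : a ∈ s)
    (hb : b ∈ s) (hc : c ∈ s) (hd : d ∈ s) (hab : a ≠ b) (hac : a ≠ c) (had : a ≠ d)
    (hbc : b ≠ c) (hbd : b ≠ d) (hcd : c ≠ d) : 4 ≤ s.ncard := by
  classical
  have h : (({a, b, c, d} : Finset α) : Set α) ⊆ s := by
    intro x hx
    simp only [Finset.coe_insert, Finset.coe_singleton, Set.mem_insert_iff,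
      Set.mem_singleton_iff] at hx
    rcases hx with rfl | rfl | rfl | rfl <;> assumption
  have h4 : ({a, b, c, d} : Finset α).card = 4 := by simp [*]
  rw [← h4, ← Set.ncard_coe_finset]
  exact Set.ncard_le_ncard h hs

theorem exists_adj_of_unique_crossing
    (hconn : ∀ K : Set V, v ∉ K → K.Nonempty → (∃ y, y ∉ K ∧ y ≠ v) →
      ∃ x ∈ K, ∃ y, y ∉ K ∧ y ≠ v ∧ G.Adj x y)
    {T A : Set V} (hv : v ∉ T)
    (huniq : ∀ x x' y y', x ∈ T → x' ∈ T → y ∉ T → y' ∉ T → y ≠ v → y' ≠ v →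
      G.Adj x y → G.Adj x' y' → x = x')
    {a b : V} (ha : a ∈ T) (haA : a ∈ A) (hb : b ∈ T) (hbA : b ∉ A) :
    ∃ x ∈ T, ∃ y ∈ T, x ∈ A ∧ y ∉ A ∧ G.Adj x y := by
  have hne : ∀ z ∈ T, z ≠ v := fun z hz h => hv (h ▸ hz)
  obtain ⟨x, ⟨hxT, hxA⟩, y, hy, hyv, hxy⟩ :=
    hconn (T ∩ A) (fun h => hv h.1) ⟨a, ha, haA⟩ ⟨b, fun h => hbA h.2, hne b hb⟩
  by_cases hyT : y ∈ T
  · exact ⟨x, hxT, y, hyT, hxA, fun h => hy ⟨hyT, h⟩, hxy⟩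
  obtain ⟨x', ⟨hxT', hxA'⟩, y', hy', hyv', hxy'⟩ :=
    hconn (T \ A) (fun h => hv h.1) ⟨b, hb, hbA⟩ ⟨a, fun h => h.2 haA, hne a ha⟩
  by_cases hyT' : y' ∈ T
  · exact ⟨y', hyT', x', hxT', by_contra fun h => hy' ⟨hyT', h⟩, hxA', hxy'.symm⟩
  · exact absurd hxA (huniq x x' y y' hxT hxT' hyT hyT' hyv hyv' hxy hxy' ▸ hxA')

theorem four_le_ncard_cutEdges_of_separated [Finite V] (hG : IsKEdgeConnected G 2)
    {K T : Set V} (hK : ∀ x ∈ K, ∀ y, y ∉ K → y ≠ v → ¬ G.Adj x y) (hv : v ∉ T)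
    {x y : V} (hxT : x ∈ T) (hxK : x ∈ K) (hyT : y ∈ T) (hyK : y ∉ K) :
    4 ≤ (cutEdges G T).ncard := by
  have hne : ∀ z ∈ T, z ≠ v := fun z hz h => hv (h ▸ hz)
  have h₁ := hG.2 (T ∩ K) ⟨x, hxT, hxK⟩ ⟨v, fun h => hv h.1⟩
  have h₂ := hG.2 (T \ K) ⟨y, hyT, hyK⟩ ⟨v, fun h => hv h.1⟩
  have hdisj : Disjoint (cutEdges G (T ∩ K)) (cutEdges G (T \ K)) := by
    rw [Set.disjoint_left]
    rintro e ⟨he, a, ha, b, hb, rfl⟩ ⟨-, c, hc, d, hd, h⟩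
    rcases Sym2.eq_iff.mp h with ⟨rfl, rfl⟩ | ⟨rfl, rfl⟩
    · exact hc.2 ha.2
    · exact hK a ha.2 b hc.2 (hne _ hc.1) he
  have hsub : cutEdges G (T ∩ K) ∪ cutEdges G (T \ K) ⊆ cutEdges G T := by
    rintro e (⟨he, a, ha, b, hb, rfl⟩ | ⟨he, a, ha, b, hb, rfl⟩)
    · refine mem_cutEdges he ha.1 fun hbT => ?_
      exact hK a ha.2 b (fun h => hb ⟨hbT, h⟩) (hne _ hbT) he
    · refine mem_cutEdges he ha.1 fun hbT => ?_
      have hbK : b ∈ K := by_contra fun h => hb ⟨hbT, h⟩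
      exact hK b hbK a ha.2 (hne _ ha.1) (G.adj_symm he)
  have := Set.ncard_le_ncard hsub (Set.toFinite _)
  rw [Set.ncard_union_eq hdisj (Set.toFinite _) (Set.toFinite _)] at this
  omega

/-- A small cut around exactly two of the neighbours of `v` is crossed by at most one edge that
avoids `v`. -/
theorem unique_crossing_of_small_cut [Finite V]
    (hconn : ∀ K : Set V, v ∉ K → K.Nonempty → (∃ y, y ∉ K ∧ y ≠ v) →
      ∃ x ∈ K, ∃ y, y ∉ K ∧ y ≠ v ∧ G.Adj x y)
    {T : Set V} (hv : v ∉ T) (hT : (cutEdges G T).ncard < 4) {w₀ w₁ w₂ w₃ : V}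
    (h₀ : G.Adj v w₀) (h₁ : G.Adj v w₁) (h₂ : G.Adj v w₂) (h₃ : G.Adj v w₃)
    (h01 : w₀ ≠ w₁) (h02 : w₀ ≠ w₂) (h03 : w₀ ≠ w₃) (h12 : w₁ ≠ w₂) (h13 : w₁ ≠ w₃)
    (h23 : w₂ ≠ w₃) (hw₀ : w₀ ∈ T) (hw₁ : w₁ ∈ T) :
    w₂ ∉ T ∧ w₃ ∉ T ∧
    ∀ x x' y y', x ∈ T → x' ∈ T → y ∉ T → y' ∉ T → y ≠ v → y' ≠ v →
      G.Adj x y → G.Adj x' y' → x = x' ∧ y = y' := by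
  have hne : ∀ z ∈ T, z ≠ v := fun z hz h => hv (h ▸ hz)
  have hmem : ∀ w, G.Adj v w → w ∈ T → s(w, v) ∈ cutEdges G T := fun w h hw =>
    mem_cutEdges h.symm hw hv
  have hvv : ∀ w w' : V, w ≠ w' → s(w, v) ≠ s(w', v) := fun w w' h h' =>
    h (Sym2.congr_left.mp h')
  have hvx : ∀ w x y : V, x ∈ T → y ≠ v → s(w, v) ≠ s(x, y) := by
    intro w x y hx hy h
    rcases Sym2.eq_iff.mp h with ⟨-, h⟩ | ⟨-, h⟩
    exacts [hy h.symm, hne x hx h.symm]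
  have hthree : ∀ a b, G.Adj v a → G.Adj v b → w₀ ≠ a → w₁ ≠ a → w₀ ≠ b → w₁ ≠ b → a ≠ b →
      a ∉ T := by
    intro a b hva hvb ha₀ ha₁ hb₀ hb₁ hab ha
    by_cases hb : b ∈ T
    · exact absurd (four_le_ncard (Set.toFinite _) (hmem _ h₀ hw₀) (hmem _ h₁ hw₁) (hmem _ hva ha)
        (hmem _ hvb hb) (hvv _ _ h01) (hvv _ _ ha₀) (hvv _ _ hb₀) (hvv _ _ ha₁) (hvv _ _ hb₁)
        (hvv _ _ hab)) (by omega)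
    · obtain ⟨x, hx, y, hy, hyv, hxy⟩ := hconn T hv ⟨_, hw₀⟩ ⟨b, hb, hvb.ne'⟩
      exact absurd (four_le_ncard (Set.toFinite _) (hmem _ h₀ hw₀) (hmem _ h₁ hw₁) (hmem _ hva ha)
        (mem_cutEdges hxy hx hy) (hvv _ _ h01) (hvv _ _ ha₀) (hvx _ _ _ hx hyv) (hvv _ _ ha₁)
        (hvx _ _ _ hx hyv) (hvx _ _ _ hx hyv)) (by omega)
  refine ⟨hthree w₂ w₃ h₂ h₃ h02 h12 h03 h13 h23,
    hthree w₃ w₂ h₃ h₂ h03 h13 h02 h12 h23.symm, ?_⟩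
  intro x x' y y' hx hx' hy hy' hyv hyv' hxy hxy'
  by_contra hcon
  refine absurd (four_le_ncard (Set.toFinite _) (hmem _ h₀ hw₀) (hmem _ h₁ hw₁)
    (mem_cutEdges hxy hx hy) (mem_cutEdges hxy' hx' hy') (hvv _ _ h01) (hvx _ _ _ hx hyv)
    (hvx _ _ _ hx' hyv') (hvx _ _ _ hx hyv) (hvx _ _ _ hx' hyv') ?_) (by omega)
  intro h
  rcases Sym2.eq_iff.mp h with h | ⟨h, -⟩
  exacts [hcon h, hy' (h ▸ hx)]

theorem exists_neighbor_of_separated (hG : IsKEdgeConnected G 2) {K : Set V} (hv : v ∉ K)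
    (hKne : K.Nonempty) (hK : ∀ x ∈ K, ∀ y, y ∉ K → y ≠ v → ¬ G.Adj x y) :
    ∃ w ∈ K, G.Adj v w := by
  have h2 := hG.2 K hKne ⟨v, hv⟩
  obtain ⟨e, he, a, ha, b, hb, rfl⟩ :=
    Set.nonempty_of_ncard_ne_zero (s := cutEdges G K) (by omega)
  by_cases hbv : b = v
  · subst hbv
    exact ⟨a, ha, G.adj_symm he⟩
  · exact absurd he (hK a ha b hb hbv)

/-- At a vertex of degree at least four, some two edges can be split off. -/
theorem exists_split_pair [Finite V] (hG : IsKEdgeConnected G 2)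
    (hdeg : 4 ≤ (G.neighborSet v).ncard) :
    ∃ w₀ w₁, w₀ ≠ w₁ ∧ G.Adj v w₀ ∧ G.Adj v w₁ ∧
      ∀ T : Set V, v ∉ T → w₀ ∈ T → w₁ ∈ T → 4 ≤ (cutEdges G T).ncard := by
  by_cases hconn : ∀ K : Set V, v ∉ K → K.Nonempty → (∃ y, y ∉ K ∧ y ≠ v) →
      ∃ x ∈ K, ∃ y, y ∉ K ∧ y ≠ v ∧ G.Adj x y
  · obtain ⟨w₀, w₁, w₂, w₃, h₀, h₁, h₂, h₃, h01, h02, h03, h12, h13, h23⟩ :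
        ∃ a b c d, G.Adj v a ∧ G.Adj v b ∧ G.Adj v c ∧ G.Adj v d ∧
          a ≠ b ∧ a ≠ c ∧ a ≠ d ∧ b ≠ c ∧ b ≠ d ∧ c ≠ d := by
      classical
      obtain ⟨s, hs, hcard⟩ := Set.exists_subset_card_eq hdeg
      obtain ⟨a, b, c, d, hab, hac, had, hbc, hbd, hcd, rfl⟩ := Set.ncard_eq_four.mp hcard
      exact ⟨a, b, c, d, hs (by simp), hs (by simp), hs (by simp), hs (by simp),
        hab, hac, had, hbc, hbd, hcd⟩
    by_contra! hbad
    obtain ⟨T₁, hv₁, h₀₁, h₁₁, hT₁⟩ := hbad w₀ w₁ h01 h₀ h₁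
    obtain ⟨T₂, hv₂, h₀₂, h₂₂, hT₂⟩ := hbad w₀ w₂ h02 h₀ h₂
    obtain ⟨h₂₁, h₃₁, hu₁⟩ :=
      unique_crossing_of_small_cut hconn hv₁ hT₁ h₀ h₁ h₂ h₃ h01 h02 h03 h12 h13 h23 h₀₁ h₁₁
    obtain ⟨h₁₂, h₃₂, hu₂⟩ :=
      unique_crossing_of_small_cut hconn hv₂ hT₂ h₀ h₂ h₁ h₃ h02 h01 h03 h12.symm h23 h13 h₀₂ h₂₂
    obtain ⟨x, hx₁, y, hy₁, hx₂, hy₂, hxy⟩ := exists_adj_of_unique_crossing hconn hv₁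
      (fun x x' y y' hx hx' hy hy' hyv hyv' h h' =>
        (hu₁ x x' y y' hx hx' hy hy' hyv hyv' h h').1) h₀₁ h₀₂ h₁₁ h₁₂
    obtain ⟨x', hx₁', y', hy₁', hx₂', hy₂', hxy'⟩ :=
      exists_adj_of_unique_crossing (T := {z | z ∉ T₁ ∧ z ≠ v}) (A := T₂) hconn (fun h => h.2 rfl)
      (fun x x' y y' hx hx' hy hy' hyv hyv' h h' =>
        (hu₁ y y' x x' (by_contra fun h => hy ⟨h, hyv⟩) (by_contra fun h => hy' ⟨h, hyv'⟩)
          hx.1 hx'.1 hx.2 hx'.2 h.symm h'.symm).2) ⟨h₂₁, h₂.ne'⟩ h₂₂ ⟨h₃₁, h₃.ne'⟩ h₃₂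
    have := (hu₂ x x' y y' hx₂ hx₂' hy₂ hy₂' (fun h => hv₁ (h ▸ hy₁)) hy₁'.2 hxy hxy').1
    exact hx₁'.1 (this ▸ hx₁)
  · push Not at hconn
    obtain ⟨K, hvK, hKne, ⟨y, hyK, hyv⟩, hK⟩ := hconn
    obtain ⟨w₀, hw₀, h₀⟩ := exists_neighbor_of_separated hG hvK hKne hK
    obtain ⟨w₁, hw₁, h₁⟩ := exists_neighbor_of_separated (K := {z | z ∉ K ∧ z ≠ v}) hG
      (fun h => h.2 rfl) ⟨y, hyK, hyv⟩ (fun a ha b hb hbv h =>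
        hK b (by_contra fun h => hb ⟨h, hbv⟩) a ha.1 ha.2 h.symm)
    exact ⟨w₀, w₁, fun h => hw₁.1 (h ▸ hw₀), h₀, h₁, fun T hv hT₀ hT₁ =>
      four_le_ncard_cutEdges_of_separated hG hK hv hT₀ hw₀ hT₁ hw₁.1⟩

end Pair

section Regular

variable {V : Type*} [Finite V]

theorem exists_isPerfectMatching_of_regular {G : SimpleGraph V} (hb : G.Colorable 2) {r : ℕ}
    (hr : 0 < r) (hG : ∀ v, (G.neighborSet v).ncard = r) :
    ∃ M : G.Subgraph, M.IsPerfectMatching := by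
  classical
  have := Fintype.ofFinite V
  obtain ⟨b⟩ := hb
  have hbip : G.IsBipartiteWith {v | b v = 0} {v | b v = 1} := by
    refine ⟨Set.disjoint_left.mpr fun v h h' => ?_, fun v w h => ?_⟩
    · exact absurd (Eq.trans (Eq.symm h) h') (by decide)
    · have := b.valid h
      simp only [Set.mem_ofPred_eq]
      omega
  refine exists_isPerfectMatching_of_forall_ncard_le hbip fun s => ?_
  have hcard : ∀ v, (G.neighborFinset v).card = r := fun v => by
    rw [← hG v, ← Set.ncard_coe_finset, coe_neighborFinset]
  have := Finset.card_mul_le_card_mul G.Adj (s := s.toFinset)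
    (t := s.toFinset.biUnion fun v => G.neighborFinset v) (m := r) (n := r) (fun a ha => by
      rw [← hcard a]
      refine Finset.card_le_card fun x hx => ?_
      simp only [Finset.mem_bipartiteAbove, Finset.mem_biUnion]
      exact ⟨⟨a, ha, hx⟩, by simpa using hx⟩)
    (fun a _ => by
      rw [← hcard a]
      refine Finset.card_le_card fun x hx => ?_
      simpa [G.adj_comm] using (Finset.mem_filter.mp hx).2)
  have := Nat.le_of_mul_le_mul_right this hr
  rw [← Set.ncard_coe_finset, ← Set.ncard_coe_finset] at this
  simpa using this

/-- The König edge coloring theorem for regular bipartite graphs: as many colors as the degree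
suffice, and every vertex then sees all of them. -/
theorem exists_isProperEdgeColoring_of_regular (r : ℕ) {G : SimpleGraph V} (hb : G.Colorable 2)
    (hG : ∀ v, (G.neighborSet v).ncard = r) :
    ∃ f : Sym2 V → ℕ, IsProperEdgeColoring G f ∧ ∀ v, colorsAt G f v = Set.Iio r := by
  induction r generalizing G with
  | zero =>
    have hadj : ∀ v w, ¬ G.Adj v w := fun v w h => by
      have := (Set.ncard_eq_zero (Set.toFinite _)).mp (hG v)
      exact (this ▸ h : w ∈ (∅ : Set V))
    refine ⟨fun _ => 0, fun e he => ?_, fun v => ?_⟩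
    · induction e with | h a b => exact absurd he (hadj a b)
    · ext k
      simp only [Set.mem_Iio, not_lt_zero, iff_false]
      rintro ⟨e, he, -, -⟩
      induction e with | h a b => exact absurd he (hadj a b)
  | succ r ih =>
    classical
    obtain ⟨M, hM⟩ := exists_isPerfectMatching_of_regular hb r.succ_pos hG
    rw [Subgraph.isPerfectMatching_iff] at hM
    have hreg : ∀ v, ((G \ M.spanningCoe).neighborSet v).ncard = r := by
      intro v
      obtain ⟨w, hw, huniq⟩ := hM v
      have : (G \ M.spanningCoe).neighborSet v = G.neighborSet v \ {w} := by
        ext x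
        simp only [mem_neighborSet, sdiff_adj, Subgraph.spanningCoe_adj, Set.mem_sdiff,
          Set.mem_singleton_iff]
        exact and_congr_right fun _ => not_congr ⟨huniq x, fun h => h ▸ hw⟩
      have hvw : w ∈ G.neighborSet v := hw.adj_sub
      rw [this, Set.ncard_sdiff_singleton_of_mem hvw, hG v, Nat.add_sub_cancel]
    obtain ⟨f, hf, hfc⟩ := ih (hb.mono_left sdiff_le) hreg
    have hmem : ∀ v w, G.Adj v w → ¬ M.Adj v w → f s(v, w) < r := fun v w h h' => by
      have : f s(v, w) ∈ colorsAt (G \ M.spanningCoe) f v := ⟨s(v, w), ⟨h, h'⟩, by simp, rfl⟩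
      rwa [hfc] at this
    let g : Sym2 V → ℕ := fun e => if e ∈ M.edgeSet then r else f e
    have hgM : ∀ v w, M.Adj v w → g s(v, w) = r := fun v w h => if_pos h
    have hgN : ∀ v w, ¬ M.Adj v w → g s(v, w) = f s(v, w) := fun v w h => if_neg h
    refine ⟨g, ?_, fun v => ?_⟩
    · rintro e₁ h₁ e₂ h₂ hne ⟨v, hv₁, hv₂⟩
      obtain ⟨w₁, rfl⟩ := Sym2.mem_iff_exists.mp hv₁
      obtain ⟨w₂, rfl⟩ := Sym2.mem_iff_exists.mp hv₂
      by_cases hM₁ : M.Adj v w₁ <;> by_cases hM₂ : M.Adj v w₂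
      · exact absurd (by rw [(hM v).unique hM₁ hM₂]) hne
      · rw [hgM _ _ hM₁, hgN _ _ hM₂]
        exact (hmem _ _ h₂ hM₂).ne'
      · rw [hgN _ _ hM₁, hgM _ _ hM₂]
        exact (hmem _ _ h₁ hM₁).ne
      · rw [hgN _ _ hM₁, hgN _ _ hM₂]
        have h₁' : (G \ M.spanningCoe).Adj v w₁ := ⟨h₁, hM₁⟩
        have h₂' : (G \ M.spanningCoe).Adj v w₂ := ⟨h₂, hM₂⟩
        exact hf _ h₁' _ h₂' hne ⟨v, hv₁, hv₂⟩
    · ext k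
      rw [Set.mem_Iio]
      constructor
      · rintro ⟨e, he, hve, rfl⟩
        obtain ⟨w, rfl⟩ := Sym2.mem_iff_exists.mp hve
        by_cases h : M.Adj v w
        · rw [hgM _ _ h]; exact r.lt_succ_self
        · rw [hgN _ _ h]; exact (hmem _ _ he h).trans r.lt_succ_self
      · intro hk
        rcases (Nat.lt_succ_iff_lt_or_eq.mp hk) with hk | rfl
        · have : k ∈ colorsAt (G \ M.spanningCoe) f v := by rwa [hfc]
          obtain ⟨e, he, hve, rfl⟩ := this
          obtain ⟨w, rfl⟩ := Sym2.mem_iff_exists.mp hve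
          exact ⟨s(v, w), he.1, hve, hgN _ _ he.2⟩
        · obtain ⟨w, hw, -⟩ := hM v
          exact ⟨s(v, w), hw.adj_sub, by simp, hgM _ _ hw⟩

theorem simultaneousEdgeColorable_of_regular {r : ℕ} (hr : 2 ≤ r) {G : SimpleGraph V}
    (hb : G.Colorable 2) (hG : ∀ v, (G.neighborSet v).ncard = r) :
    SimultaneousEdgeColorable G 2 := by
  obtain ⟨f, hf, hfc⟩ := exists_isProperEdgeColoring_of_regular r hb hG
  have hlt : ∀ e ∈ G.edgeSet, f e < r := by
    intro e he
    induction e with | h a b => ?_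
    have : f s(a, b) ∈ colorsAt G f a := ⟨s(a, b), he, by simp, rfl⟩
    rwa [hfc] at this
  have hrot : ∀ {a i : ℕ}, a < r → i < 2 → (a + i) % r = if a + i < r then a + i else 0 := by
    intro a i ha hi
    split_ifs with h
    · exact Nat.mod_eq_of_lt h
    · rw [show a + i = r by omega, Nat.mod_self]
  have hcolors : ∀ (i : Fin 2) v, colorsAt G (fun e => (f e + i) % r) v = Set.Iio r := by
    intro i v
    ext k
    rw [Set.mem_Iio]
    constructor
    · rintro ⟨e, -, -, rfl⟩
      exact Nat.mod_lt _ (by omega)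
    · intro hk
      have : (k + (r - i)) % r ∈ colorsAt G f v := by
        rw [hfc]
        exact Nat.mod_lt _ (by omega)
      obtain ⟨e, he, hve, hke⟩ := this
      refine ⟨e, he, hve, ?_⟩
      simp only [hke, Nat.mod_add_mod]
      rw [show k + (r - i) + i = k + r by omega, Nat.add_mod_right, Nat.mod_eq_of_lt hk]
  refine ⟨fun i e => (f e + i) % r, fun i => ?_, fun i j v => ?_, fun i j hij e he => ?_⟩
  · intro e₁ h₁ e₂ h₂ hne hv
    have := hf e₁ h₁ e₂ h₂ hne hv
    have := hlt _ h₁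
    have := hlt _ h₂
    dsimp only
    rw [hrot (hlt _ h₁) i.2, hrot (hlt _ h₂) i.2]
    split_ifs <;> omega
  · rw [hcolors, hcolors]
  · have := hlt _ he
    dsimp only
    rw [hrot this i.2, hrot this j.2]
    have : (i : ℕ) ≠ j := fun h => hij (Fin.ext h)
    split_ifs <;> omega

end Regular

section Iso

variable {V W : Type*} {G : SimpleGraph V} {H : SimpleGraph W}

theorem ncard_cutEdges_preimage (e : G ≃g H) (S : Set W) :
    (cutEdges G (e ⁻¹' S)).ncard = (cutEdges H S).ncard := by
  have : cutEdges H S = Sym2.map e '' cutEdges G (e ⁻¹' S) := by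
    ext x
    constructor
    · rintro ⟨hx, a, ha, b, hb, rfl⟩
      refine ⟨s(e.symm a, e.symm b), mem_cutEdges (e.symm.map_adj_iff.mpr hx) ?_ ?_, by simp⟩
      · simpa using ha
      · simpa using hb
    · rintro ⟨_, ⟨hx, a, ha, b, hb, rfl⟩, rfl⟩
      exact mem_cutEdges (e.map_adj_iff.mpr hx) ha hb
  rw [this, Set.ncard_image_of_injective _ (Sym2.map.injective e.injective)]

theorem IsKEdgeConnected.of_iso {k : ℕ} (e : G ≃g H) (hG : IsKEdgeConnected G k) :
    IsKEdgeConnected H k := by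
  refine ⟨e.connected_iff.mp hG.1, fun S hS hSc => ?_⟩
  rw [← ncard_cutEdges_preimage e]
  exact hG.2 _ (hS.preimage e.surjective) (hSc.preimage e.surjective)

theorem SimultaneousEdgeColorable.of_iso {μ : ℕ} (e : G ≃g H)
    (hH : SimultaneousEdgeColorable H μ) : SimultaneousEdgeColorable G μ := by
  obtain ⟨c, hproper, hcolors, hne⟩ := hH
  have hedge : ∀ x, x.map e ∈ H.edgeSet ↔ x ∈ G.edgeSet := fun x => by
    induction x with | h a b => exact e.map_adj_iff
  have hmap : ∀ i v, colorsAt G (fun x => c i (x.map e)) v = colorsAt H (c i) (e v) := by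
    intro i v
    ext k
    constructor
    · rintro ⟨x, hx, hv, rfl⟩
      exact ⟨x.map e, (hedge x).mpr hx, Sym2.mem_map.mpr ⟨v, hv, rfl⟩, rfl⟩
    · rintro ⟨x, hx, hv, rfl⟩
      have hxe : (x.map e.symm).map e = x := by
        induction x with | h a b => simp
      refine ⟨x.map e.symm, ?_, Sym2.mem_map.mpr ⟨e v, hv, by simp⟩, by simp only [hxe]⟩
      rwa [← hedge, hxe]
  refine ⟨fun i x => c i (x.map e), fun i x hx y hy hxy hv => ?_, fun i j v => ?_,
    fun i j hij x hx => hne i j hij _ ((hedge x).mpr hx)⟩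
  · obtain ⟨v, hvx, hvy⟩ := hv
    exact hproper i _ ((hedge x).mpr hx) _ ((hedge y).mpr hy)
      (fun h => hxy (Sym2.map.injective e.injective h))
      ⟨e v, Sym2.mem_map.mpr ⟨v, hvx, rfl⟩, Sym2.mem_map.mpr ⟨v, hvy, rfl⟩⟩
  · rw [hmap, hmap, hcolors i j]

theorem le_ncard_neighborSet [Finite V] [Nontrivial V] {k : ℕ} (hG : IsKEdgeConnected G k)
    (v : V) : k ≤ (G.neighborSet v).ncard := by
  obtain ⟨u, hu⟩ := exists_ne v
  refine (hG.2 {v} ⟨v, rfl⟩ ⟨u, hu⟩).trans ?_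
  have hsub : cutEdges G {v} ⊆ (fun w => s(v, w)) '' G.neighborSet v := by
    rintro e ⟨he, a, rfl, b, -, rfl⟩
    exact ⟨b, he, rfl⟩
  exact (Set.ncard_le_ncard hsub (Set.toFinite _)).trans (Set.ncard_image_le (Set.toFinite _))

theorem simultaneousEdgeColorable_of_subsingleton [Subsingleton V] (G : SimpleGraph V) (μ : ℕ) :
    SimultaneousEdgeColorable G μ := by
  have hempty : ∀ e, e ∉ G.edgeSet := fun e he => by
    induction e with | h a b => exact (G.ne_of_adj he) (Subsingleton.elim a b)
  refine ⟨fun _ _ => 0, fun i e he => absurd he (hempty e), fun i j v => rfl,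
    fun i j _ e he => absurd he (hempty e)⟩

end Iso

/-- A counterexample to the strong SE conjecture with the minimum number of edges and,
among those, the maximum number of vertices, has minimum degree 2 and maximum degree 3. -/
theorem extremal_counterexample_minDegree_maxDegree
    {V : Type} [Fintype V] (G : SimpleGraph V)
    (hbridgeless : IsKEdgeConnected G 2) (hbip : G.Colorable 2)
    (hnotSE : ¬ SimultaneousEdgeColorable G 2)
    (hminEdges : ∀ (k : ℕ) (G' : SimpleGraph (Fin k)), IsKEdgeConnected G' 2 →
      G'.Colorable 2 → G'.edgeSet.ncard < G.edgeSet.ncard →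
      SimultaneousEdgeColorable G' 2)
    (hmaxVerts : ∀ (k : ℕ) (G' : SimpleGraph (Fin k)), IsKEdgeConnected G' 2 →
      G'.Colorable 2 → G'.edgeSet.ncard = G.edgeSet.ncard → Fintype.card V < k →
      SimultaneousEdgeColorable G' 2)
    : (∀ v : V, 2 ≤ (G.neighborSet v).ncard) ∧ (∃ v : V, (G.neighborSet v).ncard = 2) ∧
      (∀ v : V, (G.neighborSet v).ncard ≤ 3) ∧ (∃ v : V, (G.neighborSet v).ncard = 3) := by
  rcases subsingleton_or_nontrivial V with hV | hV
  · exact absurd (simultaneousEdgeColorable_of_subsingleton G 2) hnotSE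
  have hmin : ∀ v : V, 2 ≤ (G.neighborSet v).ncard := le_ncard_neighborSet hbridgeless
  have hmax : ∀ v : V, (G.neighborSet v).ncard ≤ 3 := by
    intro v
    by_contra! hv
    obtain ⟨w₀, w₁, hne, h₀, h₁, hcut⟩ := exists_split_pair hbridgeless hv
    have e := (splitGraph G v {w₀, w₁}).overFinIso (n := Fintype.card V + 1) Fintype.card_option
    have hcard := Nat.card_congr e.mapEdgeSet
    rw [Nat.card_coe_set_eq, Nat.card_coe_set_eq, splitGraph_ncard_edgeSet] at hcard
    have hsplit : SimultaneousEdgeColorable (splitGraph G v {w₀, w₁}) 2 :=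
      .of_iso e <| hmaxVerts _ _
        ((splitGraph_isKEdgeConnected hbridgeless hne h₀ h₁ hcut).of_iso e)
        ((splitGraph_colorable hbip).of_hom e.symm.toHom) hcard.symm (Nat.lt_succ_self _)
    obtain ⟨φ, hφ⟩ := hsplit.exists_isOrientedCycleDoubleCover (splitGraph_colorable hbip)
    obtain ⟨ψ, hψ⟩ := hφ.of_splitGraph
    exact hnotSE (hψ.simultaneousEdgeColorable hbip)
  refine ⟨hmin, ?_, hmax, ?_⟩ <;> by_contra! h
  · exact hnotSE (simultaneousEdgeColorable_of_regular (r := 3) (by norm_num) hbip fun v => by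
      have := hmin v
      have := hmax v
      have := h v
      omega)
  · exact hnotSE (simultaneousEdgeColorable_of_regular (r := 2) le_rfl hbip fun v => by
      have := hmin v
      have := hmax v
      have := h v
      omega)
end
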